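/- Let π : Y → X be a continuous surjection of compact metric spaces, F : Y → Y and f : X → X continuous with π∘F = f∘π, and suppose F acts isometrically on each fiber π⁻¹(x) (so the fiber maps generate no entropy). Then for every F-invariant Borel probability measure ν on Y, h_ν(F) = h_{π_*ν}(f). -/

import Mathlib

open MeasureTheory Filter

section Defs

variable {X : Type*}

/-- The entropy `∑_{A ∈ P} -μ(A) log μ(A)` of a finite partition `P`. -/
noncomputable def partitionEntropy [MeasurableSpace X] (μ : Measure X)
    (P : Finset (Set X)) : ℝ :=
  ∑ A ∈ P, Real.negMulLog (μ A).toReal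

/-- The dynamical refinement `P ∨ f⁻¹P ∨ ⋯ ∨ f⁻⁽ⁿ⁻¹⁾P` of a finite partition. -/
noncomputable def dynRefine (f : X → X) (P : Finset (Set X)) (n : ℕ) :
    Finset (Set X) := by
  classical
  exact Finset.image
    (fun c : Fin n → {A // A ∈ P} => ⋂ k : Fin n, f^[(k : ℕ)] ⁻¹' (c k : Set X))
    Finset.univ

/-- A finite measurable partition of `X`. -/
def IsMeasPartition [MeasurableSpace X] (P : Finset (Set X)) : Prop :=
  (∀ A ∈ P, MeasurableSet A) ∧ ((P : Set (Set X)).PairwiseDisjoint id) ∧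
    ⋃₀ (P : Set (Set X)) = Set.univ

/-- The entropy of `f` relative to a finite partition `P`:
`lim (1/n) H_μ(P ∨ f⁻¹P ∨ ⋯ ∨ f⁻⁽ⁿ⁻¹⁾P)`. -/
noncomputable def dynEntropy [MeasurableSpace X] (f : X → X) (μ : Measure X)
    (P : Finset (Set X)) : ℝ :=
  Filter.atTop.liminf fun n : ℕ => partitionEntropy μ (dynRefine f P n) / n

/-- The Kolmogorov–Sinai entropy of `f` with respect to `μ`: the supremum of the
partition entropies over all finite measurable partitions. -/
noncomputable def ksEntropy [MeasurableSpace X] (f : X → X) (μ : Measure X) : EReal :=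
  ⨆ (P : Finset (Set X)) (_ : IsMeasPartition P), ((dynEntropy f μ P : ℝ) : EReal)


end Defs


namespace FibIso

/-- Shannon entropy of a finite-valued function. -/
noncomputable def HF {Y : Type*} [MeasurableSpace Y] (ν : Measure Y) {α : Type*} [Fintype α]
    (φ : Y → α) : ℝ := ∑ a, Real.negMulLog (ν.real (φ ⁻¹' {a}))

/-- Measurability of the fibers of a function. -/
def FM {Y : Type*} [MeasurableSpace Y] {α : Type*} (φ : Y → α) : Prop :=
  ∀ a, MeasurableSet (φ ⁻¹' {a})

lemma negMulLog_add_le {x y : ℝ} (hx : 0 ≤ x) (hy : 0 ≤ y) :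
    Real.negMulLog (x + y) ≤ Real.negMulLog x + Real.negMulLog y := by
  rcases hx.eq_or_lt with rfl | hx
  · simp
  rcases hy.eq_or_lt with rfl | hy
  · simp
  simp only [Real.negMulLog]
  have h1 : Real.log x ≤ Real.log (x + y) := Real.log_le_log hx (by linarith)
  have h2 : Real.log y ≤ Real.log (x + y) := Real.log_le_log hy (by linarith)
  nlinarith [mul_le_mul_of_nonneg_left h1 hx.le, mul_le_mul_of_nonneg_left h2 hy.le]

lemma negMulLog_sum_le {ι : Type*} (s : Finset ι) (x : ι → ℝ) (hx : ∀ i, 0 ≤ x i) :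
    Real.negMulLog (∑ i ∈ s, x i) ≤ ∑ i ∈ s, Real.negMulLog (x i) := by
  classical
  induction s using Finset.induction_on with
  | empty => simp
  | insert a s ha ih =>
    rw [Finset.sum_insert ha, Finset.sum_insert ha]
    exact (negMulLog_add_le (hx a) (Finset.sum_nonneg fun i _ => hx i)).trans (by linarith)

section
variable {Y : Type*} [MeasurableSpace Y] {α β : Type*} [Fintype α] [Fintype β]

lemma FM.comp {φ : Y → α} (h : FM φ) (g : α → β) : FM (fun y => g (φ y)) := by
  intro b
  have : (fun y => g (φ y)) ⁻¹' {b} = ⋃ a ∈ {a | g a = b}, φ ⁻¹' {a} := by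
    ext y; simp
  rw [this]
  exact MeasurableSet.biUnion (Set.to_countable _) fun a _ => h a

lemma FM.prod {φ : Y → α} {ψ : Y → β} (h : FM φ) (h' : FM ψ) : FM (fun y => (φ y, ψ y)) := by
  rintro ⟨a, b⟩
  have : (fun y => (φ y, ψ y)) ⁻¹' {(a, b)} = φ ⁻¹' {a} ∩ ψ ⁻¹' {b} := by
    ext y; simp
  rw [this]
  exact (h a).inter (h' b)

lemma FM.pi {ι : Type*} [Countable ι] {φ : ι → Y → α} (h : ∀ i, FM (φ i)) :
    FM (fun y i => φ i y) := by
  intro c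
  have : (fun y i => φ i y) ⁻¹' {c} = ⋂ i, φ i ⁻¹' {c i} := by
    ext y; simp [funext_iff]
  rw [this]
  exact MeasurableSet.iInter fun i => h i _

lemma FM.comp_right {Z : Type*} [MeasurableSpace Z] {φ : Y → α} (h : FM φ) {F : Z → Y}
    (hF : Measurable F) : FM (fun y => φ (F y)) := fun a => hF (h a)

variable (ν : Measure Y) [IsProbabilityMeasure ν]

lemma sum_fib {φ : Y → α} (h : FM φ) (s : Finset α) :
    ν.real (φ ⁻¹' s) = ∑ a ∈ s, ν.real (φ ⁻¹' {a}) := by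
  have : φ ⁻¹' s = ⋃ a ∈ s, φ ⁻¹' {a} := by ext y; simp
  rw [this, measureReal_biUnion_finset]
  · intro a _ b _ hab
    exact Disjoint.preimage _ (by simpa using hab)
  · exact fun a _ => h a

lemma sum_fib_univ {φ : Y → α} (h : FM φ) : ∑ a, ν.real (φ ⁻¹' {a}) = 1 := by
  rw [← sum_fib ν h]; simp

lemma HF_nonneg (φ : Y → α) : 0 ≤ HF ν φ :=
  Finset.sum_nonneg fun _ _ => Real.negMulLog_nonneg measureReal_nonneg measureReal_le_one

lemma HF_comp_le {φ : Y → α} (h : FM φ) (g : α → β) : HF ν (fun y => g (φ y)) ≤ HF ν φ := by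
  classical
  unfold HF
  rw [← Finset.sum_fiberwise Finset.univ g]
  refine Finset.sum_le_sum fun b _ => ?_
  have : (fun y => g (φ y)) ⁻¹' {b} = φ ⁻¹' ((Finset.univ.filter fun a => g a = b : Finset α)) := by
    ext y; simp
  rw [this, sum_fib ν h]
  exact negMulLog_sum_le _ _ fun _ => measureReal_nonneg

lemma HF_le_of_factors {φ : Y → α} {ψ : Y → β} (h : FM φ)
    (hf : ∀ y y', φ y = φ y' → ψ y = ψ y') : HF ν ψ ≤ HF ν φ := by
  have : Nonempty Y := nonempty_of_isProbabilityMeasure ν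
  have : Nonempty β := this.map ψ
  obtain ⟨e, he⟩ := (Function.factorsThrough_iff (f := φ) ψ).1 (fun y y' => hf y y')
  rw [he]
  exact HF_comp_le ν h e

lemma negMulLog_le_aux {x q : ℝ} (hx : 0 ≤ x) (hq : 0 ≤ q) (h : q = 0 → x = 0) :
    Real.negMulLog x ≤ - x * Real.log q + (q - x) := by
  rcases hq.eq_or_lt with rfl | hq
  · simp [h rfl]
  rcases hx.eq_or_lt with rfl | hx
  · simp [hq.le]
  have := Real.log_le_sub_one_of_pos (div_pos hq hx)
  rw [Real.log_div hq.ne' hx.ne'] at this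
  have h2 := mul_le_mul_of_nonneg_left this hx.le
  have h3 : x * (q / x - 1) = q - x := by field_simp
  simp only [Real.negMulLog]
  nlinarith

lemma HF_prod_le {φ : Y → α} {ψ : Y → β} (h : FM φ) (h' : FM ψ) :
    HF ν (fun y => (φ y, ψ y)) ≤ HF ν φ + HF ν ψ := by
  classical
  set p : α → ℝ := fun a => ν.real (φ ⁻¹' {a}) with hp
  set q : β → ℝ := fun a => ν.real (ψ ⁻¹' {a}) with hq
  set r : α → β → ℝ := fun a b => ν.real ((fun y => (φ y, ψ y)) ⁻¹' {(a, b)}) with hr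
  have hpr : ∀ a, ∑ b, r a b = p a := by
    intro a
    have := sum_fib ν (h.prod h') (Finset.univ.image fun b : β => (a, b))
    rw [Finset.sum_image (by intro x _ y _; simp)] at this
    rw [hr, ← this, hp]
    congr 1; ext y; simp [eq_comm]
  have hqr : ∀ b, ∑ a, r a b = q b := by
    intro b
    have := sum_fib ν (h.prod h') (Finset.univ.image fun a : α => (a, b))
    rw [Finset.sum_image (by intro x _ y _; simp)] at this
    rw [hr, ← this, hq]
    congr 1; ext y; simp [eq_comm]
  have hrp : ∀ a b, r a b ≤ p a := fun a b => by
    rw [← hpr a]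
    exact Finset.single_le_sum (f := fun b => r a b) (fun _ _ => measureReal_nonneg)
      (Finset.mem_univ b)
  have hrq : ∀ a b, r a b ≤ q b := fun a b => by
    rw [← hqr b]
    exact Finset.single_le_sum (f := fun a => r a b) (fun _ _ => measureReal_nonneg)
      (Finset.mem_univ a)
  have hr0 : ∀ a b, 0 ≤ r a b := fun _ _ => measureReal_nonneg
  have hp0 : ∀ a, 0 ≤ p a := fun _ => measureReal_nonneg
  have hq0 : ∀ a, 0 ≤ q a := fun _ => measureReal_nonneg
  have key : ∀ a b, Real.negMulLog (r a b) ≤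
      (- r a b * Real.log (p a) + - r a b * Real.log (q b)) + (p a * q b - r a b) := by
    intro a b
    by_cases ha : p a = 0
    · have : r a b = 0 := le_antisymm (ha ▸ hrp a b) (hr0 a b)
      simp [this, ha]
    by_cases hb : q b = 0
    · have : r a b = 0 := le_antisymm (hb ▸ hrq a b) (hr0 a b)
      simp [this, hb]
    have := negMulLog_le_aux (hr0 a b) (mul_nonneg (hp0 a) (hq0 b))
      (fun h0 => absurd h0 (mul_ne_zero ha hb))
    rw [Real.log_mul ha hb] at this
    linarith
  have e1 : HF ν (fun y => (φ y, ψ y)) = ∑ a, ∑ b, Real.negMulLog (r a b) := by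
    unfold HF; rw [Fintype.sum_prod_type]
  have sp : ∑ a, p a = 1 := sum_fib_univ ν h
  have sq : ∑ a, q a = 1 := sum_fib_univ ν h'
  have e2 : ∑ a, ∑ b, ((- r a b * Real.log (p a) + - r a b * Real.log (q b))
      + (p a * q b - r a b)) = HF ν φ + HF ν ψ := by
    simp only [Finset.sum_add_distrib, Finset.sum_sub_distrib]
    have t1 : ∑ a, ∑ b, - r a b * Real.log (p a) = HF ν φ := by
      refine Finset.sum_congr rfl fun a _ => ?_
      rw [← Finset.sum_mul, Finset.sum_neg_distrib, hpr]; rfl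
    have t2 : ∑ a, ∑ b, - r a b * Real.log (q b) = HF ν ψ := by
      rw [Finset.sum_comm]
      refine Finset.sum_congr rfl fun a _ => ?_
      rw [← Finset.sum_mul, Finset.sum_neg_distrib, hqr]; rfl
    have t3 : ∑ a, ∑ b, p a * q b = 1 := by
      simp_rw [← Finset.mul_sum, sq, mul_one, sp]
    have t4 : ∑ a, ∑ b, r a b = 1 := by simp_rw [hpr, sp]
    rw [t1, t2, t3, t4]; ring
  rw [e1, ← e2]
  exact Finset.sum_le_sum fun a _ => Finset.sum_le_sum fun b _ => key a b

lemma HF_pi_le (n : ℕ) {φ : Fin n → Y → α} (h : ∀ i, FM (φ i)) :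
    HF ν (fun y i => φ i y) ≤ ∑ i, HF ν (φ i) := by
  induction n with
  | zero =>
    have : (fun (y : Y) (i : Fin 0) => φ i y) = fun y => (fun i : Fin 0 => i.elim0) := by
      ext y i; exact i.elim0
    rw [this]
    simp only [HF, Finset.univ_eq_empty, Finset.sum_empty]
    refine (Finset.sum_eq_zero fun a _ => ?_).le
    have : (fun (y : Y) => (fun i : Fin 0 => (i.elim0 : α))) ⁻¹' {a} = Set.univ := by
      ext y; simp [eq_iff_true_of_subsingleton]
    rw [this]; simp
  | succ n ih =>
    rw [Fin.sum_univ_succ]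
    have hs : FM (fun y (i : Fin n) => φ i.succ y) := FM.pi fun i => h _
    refine le_trans ?_ ((HF_prod_le ν (h 0) hs).trans (by gcongr; exact ih fun i => h _))
    refine HF_le_of_factors ν ((h 0).prod hs) ?_
    intro y y' hy
    simp only [Prod.mk.injEq] at hy
    ext i
    refine Fin.cases hy.1 (fun j => congrFun hy.2 j) i

lemma HF_map {Z : Type*} [MeasurableSpace Z] {φ : Z → α} (h : FM φ) {F : Y → Z}
    (hF : Measurable F) : HF (ν.map F) φ = HF ν (fun y => φ (F y)) := by
  unfold HF
  refine Finset.sum_congr rfl fun a _ => ?_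
  rw [map_measureReal_apply hF (h a)]; rfl

lemma HF_iterate {φ : Y → α} (h : FM φ) {F : Y → Y} (hF : MeasurePreserving F ν ν) (k : ℕ) :
    HF ν (fun y => φ (F^[k] y)) = HF ν φ := by
  rw [← HF_map ν h (hF.iterate k).measurable, (hF.iterate k).map_eq]

end

section
variable {Y : Type*} [MeasurableSpace Y]

/-- The label of a point: an element of the partition containing it. -/
noncomputable def label {P : Finset (Set Y)} (hP : IsMeasPartition P) (y : Y) : {A // A ∈ P} :=
  ⟨Classical.choose (show ∃ A, A ∈ (P : Set (Set Y)) ∧ y ∈ A from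
      Set.mem_sUnion.1 (hP.2.2 ▸ Set.mem_univ y)),
    (Classical.choose_spec (show ∃ A, A ∈ (P : Set (Set Y)) ∧ y ∈ A from
      Set.mem_sUnion.1 (hP.2.2 ▸ Set.mem_univ y))).1⟩

lemma mem_label {P : Finset (Set Y)} (hP : IsMeasPartition P) (y : Y) :
    y ∈ (label hP y : Set Y) :=
  (Classical.choose_spec (show ∃ A, A ∈ (P : Set (Set Y)) ∧ y ∈ A from
      Set.mem_sUnion.1 (hP.2.2 ▸ Set.mem_univ y))).2

lemma label_eq_iff {P : Finset (Set Y)} (hP : IsMeasPartition P) (y : Y) (A : {A // A ∈ P}) :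
    label hP y = A ↔ y ∈ (A : Set Y) := by
  constructor
  · rintro rfl; exact mem_label hP y
  · intro h
    by_contra hne
    have := hP.2.1 (label hP y).2 A.2 (fun h => hne (Subtype.ext h))
    exact Set.disjoint_left.1 this (mem_label hP y) h

lemma label_preimage {P : Finset (Set Y)} (hP : IsMeasPartition P) (A : {A // A ∈ P}) :
    label hP ⁻¹' {A} = (A : Set Y) := by
  ext y; simp [label_eq_iff]

lemma label_FM {P : Finset (Set Y)} (hP : IsMeasPartition P) : FM (label hP) := by
  intro A
  rw [label_preimage]; exact hP.1 _ A.2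

lemma partitionEntropy_dyn {P : Finset (Set Y)} (hP : IsMeasPartition P) (ν : Measure Y)
    (F : Y → Y) (n : ℕ) :
    partitionEntropy ν (dynRefine F P n) =
      HF ν (fun y (k : Fin n) => label hP (F^[(k : ℕ)] y)) := by
  classical
  have hpre : ∀ c : Fin n → {A // A ∈ P},
      (fun y (k : Fin n) => label hP (F^[(k : ℕ)] y)) ⁻¹' {c} =
      ⋂ k : Fin n, F^[(k : ℕ)] ⁻¹' (c k : Set Y) := by
    intro c; ext y
    simp [funext_iff, label_eq_iff]
  unfold partitionEntropy dynRefine HF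
  simp_rw [hpre]
  rw [Finset.sum_image_of_pairwise_eq_zero]
  · rfl
  · intro c _ d _ hcd h
    have : (⋂ k : Fin n, F^[(k : ℕ)] ⁻¹' (c k : Set Y)) = ∅ := by
      rw [Set.eq_empty_iff_forall_notMem]
      intro y hy
      have hy2 := hy
      rw [h] at hy2
      rw [← hpre] at hy hy2
      exact hcd (hy.symm.trans hy2)
    rw [this]; simp

variable (ν : Measure Y) [IsProbabilityMeasure ν]

lemma itin_FM {P : Finset (Set Y)} (hP : IsMeasPartition P) {F : Y → Y}
    (hF : Measurable F) (n : ℕ) : FM (fun y (k : Fin n) => label hP (F^[(k : ℕ)] y)) :=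
  FM.pi fun k => (label_FM hP).comp_right (hF.iterate _)

lemma ratio_nonneg {P : Finset (Set Y)} (hP : IsMeasPartition P) (F : Y → Y) (n : ℕ) :
    0 ≤ partitionEntropy ν (dynRefine F P n) / n := by
  rw [partitionEntropy_dyn hP]
  exact div_nonneg (HF_nonneg ν _) (Nat.cast_nonneg n)

lemma ratio_le {P : Finset (Set Y)} (hP : IsMeasPartition P) {F : Y → Y}
    (hF : MeasurePreserving F ν ν) (n : ℕ) :
    partitionEntropy ν (dynRefine F P n) / n ≤ HF ν (label hP) := by
  rw [partitionEntropy_dyn hP]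
  refine div_le_of_le_mul₀ (Nat.cast_nonneg n) (HF_nonneg ν _) ?_
  refine (HF_pi_le ν n (φ := fun k y => label hP (F^[(k : ℕ)] y))
    fun k => (label_FM hP).comp_right (hF.measurable.iterate _)).trans ?_
  simp_rw [HF_iterate ν (label_FM hP) hF]
  simp [mul_comm]

lemma ratio_bdd {P : Finset (Set Y)} (hP : IsMeasPartition P) (F : Y → Y) :
    IsBoundedUnder (· ≥ ·) atTop
      (fun n : ℕ => partitionEntropy ν (dynRefine F P n) / n) :=
  isBoundedUnder_of ⟨0, fun n => ratio_nonneg ν hP F n⟩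

lemma ratio_cobdd {P : Finset (Set Y)} (hP : IsMeasPartition P) {F : Y → Y}
    (hF : MeasurePreserving F ν ν) :
    IsCoboundedUnder (· ≥ ·) atTop
      (fun n : ℕ => partitionEntropy ν (dynRefine F P n) / n) :=
  (isBoundedUnder_of ⟨HF ν (label hP), fun n => ratio_le ν hP hF n⟩ :
    IsBoundedUnder (· ≤ ·) atTop _).isCoboundedUnder_ge

/-- A partition from a finite-valued function with measurable fibers. -/
lemma exists_partition_of_FM {α : Type*} [Fintype α] {φ : Y → α} (h : FM φ) :
    ∃ P : Finset (Set Y), IsMeasPartition P ∧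
      ∀ A ∈ P, ∀ y ∈ A, ∀ y' ∈ A, φ y = φ y' := by
  classical
  refine ⟨Finset.univ.image fun a => φ ⁻¹' {a}, ⟨?_, ?_, ?_⟩, ?_⟩
  · intro A hA
    obtain ⟨a, -, rfl⟩ := Finset.mem_image.1 hA
    exact h a
  · intro A hA B hB hAB
    obtain ⟨a, -, rfl⟩ := Finset.mem_image.1 hA
    obtain ⟨b, -, rfl⟩ := Finset.mem_image.1 hB
    refine Disjoint.preimage _ ?_
    rw [Set.disjoint_singleton]
    rintro rfl
    exact hAB rfl
  · ext y; simp
  · intro A hA y hy y' hy'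
    obtain ⟨a, -, rfl⟩ := Finset.mem_image.1 hA
    exact hy.trans hy'.symm

end

lemma exists_small_FM {Y : Type*} [MetricSpace Y] [CompactSpace Y] [MeasurableSpace Y]
    [BorelSpace Y] {δ : ℝ} (hδ : 0 < δ) :
    ∃ (m : ℕ) (D : Y → (Fin m → Bool)), FM D ∧ ∀ y y', D y = D y' → dist y y' < δ := by
  classical
  obtain ⟨t, -, ht, hc⟩ := finite_cover_balls_of_compact (isCompact_univ (X := Y)) (half_pos hδ)
  obtain ⟨m, ⟨e⟩⟩ := finite_iff_exists_equiv_fin.1 (show Finite t from ht)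
  refine ⟨m, fun y i => decide (y ∈ Metric.ball (e.symm i : Y) (δ / 2)), FM.pi fun i => ?_, ?_⟩
  · intro b
    cases b
    · have : (fun y => decide (y ∈ Metric.ball (e.symm i : Y) (δ / 2))) ⁻¹' {false} =
          (Metric.ball (e.symm i : Y) (δ / 2))ᶜ := by ext y; simp
      rw [this]; exact Metric.isOpen_ball.measurableSet.compl
    · have : (fun y => decide (y ∈ Metric.ball (e.symm i : Y) (δ / 2))) ⁻¹' {true} =
          (Metric.ball (e.symm i : Y) (δ / 2)) := by ext y; simp
      rw [this]; exact Metric.isOpen_ball.measurableSet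
  · intro y y' h
    obtain ⟨c, hct, hy⟩ := Set.mem_iUnion₂.1 (hc (Set.mem_univ y))
    have := congrFun h (e ⟨c, hct⟩)
    simp only [Equiv.symm_apply_apply, decide_eq_decide] at this
    have hy' := this.1 hy
    rw [Metric.mem_ball] at hy hy'
    have := dist_triangle_right y y' c
    linarith

/-- Approximation of a finite partition by closed sets, up to small entropy. -/
lemma exists_approx {Y : Type*} [MetricSpace Y] [CompactSpace Y] [MeasurableSpace Y]
    [BorelSpace Y] (ν : Measure Y) [IsProbabilityMeasure ν] {α : Type*} [Fintype α]
    {φ : Y → α} (h : FM φ) {ε : ℝ} (hε : 0 < ε) :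
    ∃ (w : Y → Option α) (δ : ℝ), FM w ∧ 0 < δ ∧ HF ν w < ε ∧
      ∀ y y', w y = w y' → dist y y' < δ → φ y = φ y' := by
  classical
  -- continuity choice
  have hcont : Tendsto (fun p : α → ℝ => Real.negMulLog (1 - ∑ a, p a) +
      ∑ a, Real.negMulLog (p a)) (nhds 0) (nhds 0) := by
    have : Continuous (fun p : α → ℝ => Real.negMulLog (1 - ∑ a, p a) +
      ∑ a, Real.negMulLog (p a)) := by fun_prop
    simpa using this.tendsto 0
  obtain ⟨η, hη, hη'⟩ := Metric.eventually_nhds_iff.1 (hcont.eventually (gt_mem_nhds hε))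
  have hK : ∀ a, ∃ K ⊆ φ ⁻¹' {a}, IsClosed K ∧ ν (φ ⁻¹' {a} \ K) < ENNReal.ofReal η := fun a =>
    (h a).exists_isClosed_sdiff_lt (measure_ne_top _ _) (by simpa using hη)
  choose K hKs hKc hKν using hK
  let w : Y → Option α := fun y => if y ∈ K (φ y) then none else some (φ y)
  have hws : ∀ a, w ⁻¹' {some a} = φ ⁻¹' {a} \ K a := by
    intro a; ext y
    simp only [w, Set.mem_preimage, Set.mem_singleton_iff, Set.mem_sdiff]
    split_ifs with hy
    · simp only [reduceCtorEq, false_iff, not_and, not_not]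
      rintro rfl; exact hy
    · simp only [Option.some.injEq]
      constructor
      · rintro rfl; exact ⟨rfl, hy⟩
      · exact fun h => h.1
  have hwn : w ⁻¹' {none} = ⋃ a, K a := by
    ext y
    simp only [w, Set.mem_preimage, Set.mem_singleton_iff, Set.mem_iUnion]
    split_ifs with hy
    · simp only [true_iff]; exact ⟨_, hy⟩
    · simp only [reduceCtorEq, false_iff, not_exists]
      intro a ha
      have : φ y = a := hKs a ha
      exact hy (this ▸ ha)
  have hwM : FM w := by
    intro o
    cases o with
    | none => rw [hwn]; exact MeasurableSet.iUnion fun a => (hKc a).measurableSet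
    | some a => rw [hws]; exact (h a).diff (hKc a).measurableSet
  have hsum := sum_fib_univ ν hwM
  rw [Fintype.sum_option] at hsum
  have hH : HF ν w < ε := by
    have := @hη' (fun a => ν.real (w ⁻¹' {some a})) ?_
    · unfold HF
      rw [Fintype.sum_option]
      rw [← hsum] at this
      simpa using this
    · rw [dist_pi_lt_iff hη]
      intro a
      rw [Pi.zero_apply, Real.dist_0_eq_abs, abs_of_nonneg measureReal_nonneg, hws]
      exact (ENNReal.lt_ofReal_iff_toReal_lt (measure_ne_top _ _)).1 (hKν a)
  -- distance
  let S : Set (Y × Y) := ⋃ p : {p : α × α // p.1 ≠ p.2}, K p.1.1 ×ˢ K p.1.2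
  have hS : IsCompact S := isCompact_iUnion fun p =>
    ((hKc _).prod (hKc _)).isCompact
  have hδ : ∃ δ > 0, ∀ p ∈ S, δ ≤ dist p.1 p.2 := by
    rcases S.eq_empty_or_nonempty with h0 | h0
    · exact ⟨1, one_pos, by simp [h0]⟩
    obtain ⟨p, hp, hmin⟩ := hS.exists_isMinOn h0 (f := fun p => dist p.1 p.2) (by fun_prop)
    refine ⟨_, ?_, fun q hq => hmin hq⟩
    apply dist_pos.2
    intro he
    obtain ⟨⟨⟨a, b⟩, hab⟩, h1, h2⟩ := Set.mem_iUnion.1 hp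
    have e1 : φ p.1 = a := hKs _ h1
    have e2 : φ p.2 = b := hKs _ h2
    exact hab (by rw [← e1, ← e2, he])
  obtain ⟨δ, hδ, hS'⟩ := hδ
  refine ⟨w, δ, hwM, hδ, hH, ?_⟩
  intro y y' hw hd
  by_cases hy : y ∈ K (φ y) <;> by_cases hy' : y' ∈ K (φ y') <;> simp [w, hy, hy'] at hw
  · by_contra hne
    exact absurd (hS' (y, y') (Set.mem_iUnion.2 ⟨⟨(φ y, φ y'), hne⟩, hy, hy'⟩)) (not_le.2 hd)
  · exact hw

section
variable {X Y : Type*} [MetricSpace X] [CompactSpace X] [MeasurableSpace X] [BorelSpace X]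
    [MetricSpace Y] [CompactSpace Y] [MeasurableSpace Y] [BorelSpace Y]
    {π : Y → X} {F : Y → Y} {f : X → X}

lemma comm_iter {X Y : Type*} {π : Y → X} {F : Y → Y} {f : X → X}
    (hcomm : ∀ y, π (F y) = f (π y)) (k : ℕ) (y : Y) :
    π (F^[k] y) = f^[k] (π y) := by
  induction k generalizing y with
  | zero => rfl
  | succ k ih => rw [Function.iterate_succ_apply, Function.iterate_succ_apply, ih, hcomm]

lemma iso_iter {X Y : Type*} [MetricSpace Y] {π : Y → X} {F : Y → Y} {f : X → X}
    (hcomm : ∀ y, π (F y) = f (π y))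
    (hiso : ∀ y₁ y₂, π y₁ = π y₂ → dist (F y₁) (F y₂) = dist y₁ y₂) (k : ℕ) (y y' : Y)
    (h : π y = π y') : dist (F^[k] y) (F^[k] y') = dist y y' := by
  induction k generalizing y y' with
  | zero => rfl
  | succ k ih =>
    rw [Function.iterate_succ_apply, Function.iterate_succ_apply, ih _ _ (by rw [hcomm, hcomm, h]),
      hiso _ _ h]

lemma exists_eta {X Y : Type*} [MetricSpace X] [MetricSpace Y] [CompactSpace Y]
    {π : Y → X} {F : Y → Y} {f : X → X} (hπc : Continuous π) (hFc : Continuous F)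
    (hcomm : ∀ y, π (F y) = f (π y))
    (hiso : ∀ y₁ y₂, π y₁ = π y₂ → dist (F y₁) (F y₂) = dist y₁ y₂) (N : ℕ) {δ : ℝ}
    (hδ : 0 < δ) : ∃ η > 0, ∀ y y', dist y y' < δ / 2 → dist (π y) (π y') < η →
      ∀ r < N, dist (F^[r] y) (F^[r] y') < δ := by
  let S : Set (Y × Y) := ⋃ r : Fin N, {p | dist p.1 p.2 ≤ δ / 2 ∧
    δ ≤ dist (F^[(r : ℕ)] p.1) (F^[(r : ℕ)] p.2)}
  have hS : IsCompact S := isCompact_iUnion fun r => by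
    have := hFc.iterate r
    have c1 : IsClosed {p : Y × Y | dist p.1 p.2 ≤ δ / 2} := isClosed_le (by fun_prop) (by fun_prop)
    have c2 : IsClosed {p : Y × Y | δ ≤ dist (F^[(r : ℕ)] p.1) (F^[(r : ℕ)] p.2)} :=
      isClosed_le (by fun_prop) (by fun_prop)
    exact (c1.inter c2).isCompact
  have hη : ∃ η > 0, ∀ p ∈ S, η ≤ dist (π p.1) (π p.2) := by
    rcases S.eq_empty_or_nonempty with h0 | h0
    · exact ⟨1, one_pos, by simp [h0]⟩
    obtain ⟨p, hp, hmin⟩ := hS.exists_isMinOn h0 (f := fun p => dist (π p.1) (π p.2))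
      (by fun_prop)
    refine ⟨_, ?_, fun q hq => hmin hq⟩
    apply dist_pos.2
    intro he
    obtain ⟨r, h1, h2⟩ := Set.mem_iUnion.1 hp
    rw [iso_iter hcomm hiso r _ _ he] at h2
    linarith
  obtain ⟨η, hη, hS'⟩ := hη
  refine ⟨η, hη, fun y y' h1 h2 r hr => ?_⟩
  by_contra hcon
  exact absurd (hS' (y, y') (Set.mem_iUnion.2 ⟨⟨r, hr⟩, h1.le, not_lt.1 hcon⟩)) (not_le.2 h2)

lemma upper (hπc : Continuous π) (hFc : Continuous F) (hfc : Continuous f)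
    (hcomm : ∀ y, π (F y) = f (π y))
    (hiso : ∀ y₁ y₂, π y₁ = π y₂ → dist (F y₁) (F y₂) = dist y₁ y₂)
    (ν : Measure Y) [IsProbabilityMeasure ν] (hν : MeasurePreserving F ν ν)
    (hμ : MeasurePreserving f (Measure.map π ν) (Measure.map π ν))
    [IsProbabilityMeasure (Measure.map π ν)]
    {P : Finset (Set Y)} (hP : IsMeasPartition P) {ε : ℝ} (hε : 0 < ε) :
    ∃ R : Finset (Set X), IsMeasPartition R ∧
      dynEntropy F ν P ≤ dynEntropy f (Measure.map π ν) R + 3 * ε := by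
  obtain ⟨w, δ, hwM, hδ, hwH, hw⟩ := exists_approx ν (label_FM hP) hε
  obtain ⟨m, D, hDM, hD⟩ := exists_small_FM (Y := Y) (half_pos hδ)
  obtain ⟨N, hN⟩ := exists_nat_gt (HF ν D / ε)
  have hN0 : 0 < N := by
    have : (0 : ℝ) < N := (div_nonneg (HF_nonneg ν D) hε.le).trans_lt hN
    exact_mod_cast this
  obtain ⟨η, hη, hηN⟩ := exists_eta hπc hFc hcomm hiso N hδ
  obtain ⟨m', E, hEM, hE⟩ := exists_small_FM (Y := X) hη
  obtain ⟨R, hR, hRE⟩ := exists_partition_of_FM hEM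
  refine ⟨R, hR, ?_⟩
  have hFm := hFc.measurable
  have main : ∀ n : ℕ, partitionEntropy ν (dynRefine F P n) ≤
      partitionEntropy (Measure.map π ν) (dynRefine f R n) +
        ((n / N + 1 : ℕ) * HF ν D + n * ε) := by
    intro n
    rw [partitionEntropy_dyn hP, partitionEntropy_dyn hR,
      HF_map ν (itin_FM hR hfc.measurable n) hπc.measurable]
    have m1 := (itin_FM hR hfc.measurable n).comp_right hπc.measurable
    have m2 : ∀ j : Fin (n / N + 1), FM (fun y => D (F^[(j : ℕ) * N] y)) :=
      fun j => hDM.comp_right (hFm.iterate _)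
    have m3 : ∀ j : Fin n, FM (fun y => w (F^[(j : ℕ)] y)) :=
      fun j => hwM.comp_right (hFm.iterate _)
    have b2 := HF_pi_le ν _ m2
    have b3 := HF_pi_le ν _ m3
    simp_rw [HF_iterate ν hDM hν] at b2
    simp_rw [HF_iterate ν hwM hν] at b3
    simp only [Finset.sum_const, Finset.card_univ, Fintype.card_fin, nsmul_eq_mul] at b2 b3
    have b4 : (n : ℝ) * HF ν w ≤ n * ε := by gcongr
    have b5 := HF_prod_le ν m1 ((FM.pi m2).prod (FM.pi m3))
    have b6 := HF_prod_le ν (FM.pi m2) (FM.pi m3)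
    refine le_trans (HF_le_of_factors ν (m1.prod ((FM.pi m2).prod (FM.pi m3))) ?_)
      (b5.trans (by linarith))
    intro y y' hyy
    simp only [Prod.mk.injEq] at hyy
    obtain ⟨h1, h2, h3⟩ := hyy
    funext k
    have hk3 := congrFun h3 k
    refine hw _ _ hk3 ?_
    have hmod : (k : ℕ) = (k : ℕ) % N + (k / N : ℕ) * N := (Nat.mod_add_div' _ _).symm
    rw [hmod, Function.iterate_add_apply, Function.iterate_add_apply]
    refine hηN _ _ (hD _ _ ?_) (hE _ _ ?_) _ (Nat.mod_lt _ hN0)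
    · exact congrFun h2 ⟨(k : ℕ) / N, Nat.lt_succ_of_le (Nat.div_le_div_right k.2.le)⟩
    · have hlt : (k / N : ℕ) * N < n := (Nat.div_mul_le_self _ _).trans_lt k.2
      have := congrFun h1 ⟨_, hlt⟩
      simp only at this
      rw [comm_iter hcomm, comm_iter hcomm]
      refine hRE _ (label hR (f^[(k / N : ℕ) * N] (π y))).2 _ (mem_label hR _) _ ?_
      rw [this]
      exact mem_label hR _
  have ev : ∀ᶠ n : ℕ in atTop, partitionEntropy ν (dynRefine F P n) / n ≤
      partitionEntropy (Measure.map π ν) (dynRefine f R n) / n + 3 * ε := by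
    obtain ⟨n0, hn0⟩ := exists_nat_gt (HF ν D / ε)
    filter_upwards [eventually_ge_atTop (n0 + 1)] with n hn
    have hn1 : (n0 : ℝ) + 1 ≤ n := by exact_mod_cast hn
    have hnpos : (0 : ℝ) < n := by
      have : (0 : ℝ) ≤ n0 := Nat.cast_nonneg _
      linarith
    rw [div_le_iff₀ hnpos, add_mul, div_mul_cancel₀ _ hnpos.ne']
    refine (main n).trans ?_
    rw [div_lt_iff₀ hε] at hN hn0
    have q1 : ((n / N : ℕ) : ℝ) * HF ν D ≤ n * ε := by
      have : ((n / N : ℕ) : ℝ) * N ≤ n := by exact_mod_cast Nat.div_mul_le_self n N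
      calc ((n / N : ℕ) : ℝ) * HF ν D ≤ (n / N : ℕ) * (N * ε) := by gcongr
        _ = ((n / N : ℕ) * N) * ε := by ring
        _ ≤ n * ε := by gcongr
    have q2 : HF ν D ≤ n * ε := hn0.le.trans (by gcongr; linarith)
    push_cast at q1 ⊢
    linarith
  unfold dynEntropy
  rw [← liminf_add_const atTop _ _ (ratio_cobdd _ hR hμ) (ratio_bdd _ hR f)]
  refine liminf_le_liminf ev (ratio_bdd ν hP F) ?_
  refine (isBoundedUnder_of ⟨HF (Measure.map π ν) (label hR) + 3 * ε, fun n => ?_⟩ :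
    IsBoundedUnder (· ≤ ·) atTop _).isCoboundedUnder_ge
  have := ratio_le _ hR hμ n
  linarith

lemma lower (hπc : Continuous π) (hFc : Continuous F) (hfc : Continuous f)
    (hcomm : ∀ y, π (F y) = f (π y))
    (ν : Measure Y) [IsProbabilityMeasure ν]
    {R : Finset (Set X)} (hR : IsMeasPartition R) :
    ∃ P : Finset (Set Y), IsMeasPartition P ∧
      dynEntropy f (Measure.map π ν) R = dynEntropy F ν P := by
  classical
  have hP : IsMeasPartition (R.image fun A => π ⁻¹' A) := by
    refine ⟨?_, ?_, ?_⟩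
    · intro A hA
      obtain ⟨B, hB, rfl⟩ := Finset.mem_image.1 hA
      exact hπc.measurable (hR.1 B hB)
    · intro A hA A' hA' hne
      obtain ⟨B, hB, rfl⟩ := Finset.mem_image.1 hA
      obtain ⟨B', hB', rfl⟩ := Finset.mem_image.1 hA'
      refine Disjoint.preimage π (hR.2.1 hB hB' ?_)
      rintro rfl; exact hne rfl
    · rw [Set.eq_univ_iff_forall]
      intro y
      exact ⟨π ⁻¹' (label hR (π y)), Finset.mem_coe.2 (Finset.mem_image_of_mem _ (label hR (π y)).2),
        mem_label hR _⟩
  have key : ∀ y y', label hP y = label hP y' ↔ label hR (π y) = label hR (π y') := by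
    intro y y'
    constructor
    · intro h
      obtain ⟨B, hB, hB'⟩ := Finset.mem_image.1 (label hP y).2
      have h1 : y ∈ π ⁻¹' B := by rw [hB']; exact mem_label hP y
      have h2 : y' ∈ π ⁻¹' B := by rw [hB', h]; exact mem_label hP y'
      rw [(label_eq_iff hR (π y) ⟨B, hB⟩).2 h1, (label_eq_iff hR (π y') ⟨B, hB⟩).2 h2]
    · intro h
      have hm : π ⁻¹' (label hR (π y)) ∈ R.image fun A => π ⁻¹' A :=
        Finset.mem_image_of_mem _ (label hR (π y)).2
      rw [(label_eq_iff hP y ⟨_, hm⟩).2 (mem_label hR (π y)), eq_comm, label_eq_iff hP y']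
      show π y' ∈ (label hR (π y) : Set X)
      rw [h]; exact mem_label hR _
  refine ⟨_, hP, ?_⟩
  unfold dynEntropy
  congr 1
  funext n
  congr 1
  rw [partitionEntropy_dyn hP, partitionEntropy_dyn hR,
      HF_map ν (itin_FM hR hfc.measurable n) hπc.measurable]
  apply le_antisymm
  · refine HF_le_of_factors ν (itin_FM hP hFc.measurable n) fun y y' h => ?_
    funext k
    have := (key _ _).1 (congrFun h k)
    rwa [comm_iter hcomm, comm_iter hcomm] at this
  · refine HF_le_of_factors ν ((itin_FM hR hfc.measurable n).comp_right hπc.measurable)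
      fun y y' h => ?_
    funext k
    refine (key _ _).2 ?_
    rw [comm_iter hcomm, comm_iter hcomm]
    exact congrFun h k

end

end FibIso

/-- Ledrappier–Walters in the isometric-fiber case: if `π : Y → X` is a continuous
surjection of compact metric spaces intertwining `F` and `f`, and `F` acts
isometrically on the fibers of `π` (so the fiber maps generate no entropy), then
`h_ν(F) = h_{π_*ν}(f)` for every `F`-invariant Borel probability measure `ν`. -/
theorem fiber_isometric_entropy_eq
    {X Y : Type*} [MetricSpace X] [CompactSpace X] [MeasurableSpace X] [BorelSpace X]
    [MetricSpace Y] [CompactSpace Y] [MeasurableSpace Y] [BorelSpace Y]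
    (π : Y → X) (hπc : Continuous π) (hπs : Function.Surjective π)
    (F : Y → Y) (f : X → X) (hFc : Continuous F) (hfc : Continuous f)
    (hcomm : ∀ y, π (F y) = f (π y))
    (hiso : ∀ y₁ y₂, π y₁ = π y₂ → dist (F y₁) (F y₂) = dist y₁ y₂)
    (ν : Measure Y) [IsProbabilityMeasure ν] (hν : MeasurePreserving F ν ν) :
    ksEntropy F ν = ksEntropy f (Measure.map π ν) := by
  have hπm := hπc.measurable
  have : IsProbabilityMeasure (Measure.map π ν) := Measure.isProbabilityMeasure_map hπm.aemeasurable
  have hμ : MeasurePreserving f (Measure.map π ν) (Measure.map π ν) := by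
    refine ⟨hfc.measurable, ?_⟩
    rw [Measure.map_map hfc.measurable hπm]
    have : f ∘ π = π ∘ F := by funext y; exact (hcomm y).symm
    rw [this, ← Measure.map_map hπm hFc.measurable, hν.map_eq]
  apply le_antisymm
  · refine iSup₂_le fun P hP => ?_
    refine EReal.le_of_forall_lt_iff_le.1 fun c hc => ?_
    by_contra hlt
    rw [not_le, EReal.coe_lt_coe_iff] at hlt
    obtain ⟨R, hR, hle⟩ := FibIso.upper hπc hFc hfc hcomm hiso ν hν hμ hP
      (ε := (dynEntropy F ν P - c) / 6) (by linarith)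
    have h1 : ((dynEntropy f (Measure.map π ν) R : ℝ) : EReal) ≤ ksEntropy f (Measure.map π ν) :=
      le_iSup₂ (f := fun (P : Finset (Set X)) (_ : IsMeasPartition P) =>
        ((dynEntropy f (Measure.map π ν) P : ℝ) : EReal)) R hR
    have h2 := EReal.coe_lt_coe_iff.1 (h1.trans_lt hc)
    linarith
  · refine iSup₂_le fun R hR => ?_
    obtain ⟨P, hP, he⟩ := FibIso.lower hπc hFc hfc hcomm ν hR
    rw [he]
    exact le_iSup₂ (f := fun (P : Finset (Set Y)) (_ : IsMeasPartition P) =>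
        ((dynEntropy F ν P : ℝ) : EReal)) P hP
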